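/- (Korn's inequality on the horizontally periodic slab with bottom Dirichlet condition, Lemma B.6.) There exists a constant C>0 depending only on L₁, L₂ and b such that every horizontally periodic continuously differentiable vector field u:ℝ³→ℝ³ satisfying u(x₁,x₂,−b)=0 for all (x₁,x₂)∈ℝ² obeys ∫_Ω (|u|² + |∇u|²) ≤ C∫_Ω |𝔻u|². -/

import Mathlib

open MeasureTheory Set

structure KC1 (f fx fz : ℝ × ℝ → ℝ) : Prop where
  c : Continuous f
  cx : Continuous fx
  cz : Continuous fz
  dx : ∀ x z, HasDerivAt (fun t => f (t, z)) (fx (x, z)) x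
  dz : ∀ x z, HasDerivAt (fun t => f (x, t)) (fz (x, z)) z

lemma k_param {f : ℝ × ℝ → ℝ} (hf : Continuous f) (a b : ℝ) :
    Continuous fun z => ∫ x in a..b, f (x, z) :=
  intervalIntegral.continuous_parametric_intervalIntegral_of_continuous'
    (f := fun z x => f (x, z)) (by unfold Function.uncurry; fun_prop) a b

lemma k_quot {f fx fz : ℝ × ℝ → ℝ} (hf : KC1 f fx fz) (x z h : ℝ) :
    f (x, z + h) - f (x, z) = h * ∫ t in (0:ℝ)..1, fz (x, z + h * t) := by
  have hc := hf.cz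
  have := intervalIntegral.mul_integral_comp_add_mul (a := 0) (b := 1) (f := fun t => fz (x, t)) h z
  rw [this, intervalIntegral.integral_eq_sub_of_hasDerivAt (f := fun t => f (x, t))
    (fun t _ => hf.dz x t) (Continuous.intervalIntegrable (by fun_prop) _ _)]
  simp

lemma k_perx {f fx fz : ℝ × ℝ → ℝ} (hf : KC1 f fx fz) {P : ℝ}
    (hP : ∀ x z, f (x + P, z) = f (x, z)) (x z : ℝ) : fx (x + P, z) = fx (x, z) := by
  have h1 := (hf.dx (x + P) z).comp_add_const x P
  have : (fun t => f (t + P, z)) = fun t => f (t, z) := by ext t; exact hP t z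
  rw [this] at h1
  exact h1.unique (hf.dx x z)

lemma k_fxeq {f fx fz : ℝ × ℝ → ℝ} (hf : KC1 f fx fz) {z z' : ℝ}
    (h : ∀ x, f (x, z) = f (x, z')) (x : ℝ) : fx (x, z) = fx (x, z') := by
  have h1 := hf.dx x z
  have : (fun t => f (t, z)) = fun t => f (t, z') := by ext t; exact h t
  rw [this] at h1
  exact h1.unique (hf.dx x z')

lemma k_parts {f fx fz g gx gz : ℝ × ℝ → ℝ} (hf : KC1 f fx fz) (hg : KC1 g gx gz) {P : ℝ}
    (hPf : ∀ x z, f (x + P, z) = f (x, z)) (hPg : ∀ x z, g (x + P, z) = g (x, z)) (z w : ℝ) :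
    ∫ x in (0:ℝ)..P, fx (x, z) * g (x, w) = - ∫ x in (0:ℝ)..P, f (x, z) * gx (x, w) := by
  have c1 := hf.c; have c2 := hf.cx; have c3 := hg.c; have c4 := hg.cx
  have h := intervalIntegral.integral_eq_sub_of_hasDerivAt (a := 0) (b := P)
    (f := fun t => f (t, z) * g (t, w)) (fun t _ => (hf.dx t z).mul (hg.dx t w))
    (Continuous.intervalIntegrable (by fun_prop) _ _)
  rw [intervalIntegral.integral_add (Continuous.intervalIntegrable (by fun_prop) _ _)
    (Continuous.intervalIntegrable (by fun_prop) _ _)] at h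
  have e1 := hPf 0 z
  have e2 := hPg 0 w
  rw [zero_add] at e1 e2
  rw [e1, e2] at h
  linarith

lemma k_deriv {f fx fz g gx gz : ℝ × ℝ → ℝ} (hf : KC1 f fx fz) (hg : KC1 g gx gz) {P : ℝ}
    (hPf : ∀ x z, f (x + P, z) = f (x, z)) (hPg : ∀ x z, g (x + P, z) = g (x, z)) (z : ℝ) :
    HasDerivAt (fun z => ∫ x in (0:ℝ)..P, fx (x, z) * g (x, z))
      (∫ x in (0:ℝ)..P, (fx (x, z) * gz (x, z) - fz (x, z) * gx (x, z))) z := by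
  have c1 := hf.c; have c2 := hf.cx; have c3 := hg.c; have c4 := hg.cx
  have c5 := hf.cz; have c6 := hg.cz
  have kp : ∀ k : ℝ × ℝ → ℝ, Continuous k →
      Continuous fun q : ℝ × ℝ => ∫ t in (0:ℝ)..1, k (q.1, z + q.2 * t) := fun k hk =>
    intervalIntegral.continuous_parametric_intervalIntegral_of_continuous'
      (f := fun (q : ℝ × ℝ) t => k (q.1, z + q.2 * t)) (by unfold Function.uncurry; fun_prop) 0 1
  have kf := kp fz c5
  have kg := kp gz c6
  set Df : ℝ × ℝ → ℝ := fun q => ∫ t in (0:ℝ)..1, fz (q.1, z + q.2 * t) with hDf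
  set Dg : ℝ × ℝ → ℝ := fun q => ∫ t in (0:ℝ)..1, gz (q.1, z + q.2 * t) with hDg
  have qf : ∀ x h, f (x, z + h) - f (x, z) = h * Df (x, h) := fun x h => k_quot hf x z h
  have qg : ∀ x h, g (x, z + h) - g (x, z) = h * Dg (x, h) := fun x h => k_quot hg x z h
  have hQ : Continuous fun h => ∫ x in (0:ℝ)..P,
      (fx (x, z + h) * Dg (x, h) - Df (x, h) * gx (x, z)) :=
    k_param (f := fun q => fx (q.1, z + q.2) * Dg q - Df q * gx (q.1, z)) (by fun_prop) 0 P
  have h0 : ∫ x in (0:ℝ)..P, (fx (x, z + 0) * Dg (x, 0) - Df (x, 0) * gx (x, z))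
      = ∫ x in (0:ℝ)..P, (fx (x, z) * gz (x, z) - fz (x, z) * gx (x, z)) := by
    simp [hDf, hDg]
  have key : ∀ h, (∫ x in (0:ℝ)..P, fx (x, z + h) * g (x, z + h))
      - (∫ x in (0:ℝ)..P, fx (x, z) * g (x, z))
      = h * ∫ x in (0:ℝ)..P, (fx (x, z + h) * Dg (x, h) - Df (x, h) * gx (x, z)) := by
    intro h
    have p1 := k_parts hf hg hPf hPg (z + h) z
    have p2 := k_parts hf hg hPf hPg z z
    rw [← intervalIntegral.integral_const_mul]
    have : ∀ x, h * (fx (x, z + h) * Dg (x, h) - Df (x, h) * gx (x, z))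
      = ((fx (x, z + h) * g (x, z + h) - fx (x, z + h) * g (x, z)) - f (x, z + h) * gx (x, z))
        + f (x, z) * gx (x, z) := by
      intro x
      linear_combination (-fx (x, z + h)) * qg x h + gx (x, z) * qf x h
    simp_rw [this]
    rw [intervalIntegral.integral_add, intervalIntegral.integral_sub,
      intervalIntegral.integral_sub]
    · linarith
    all_goals exact Continuous.intervalIntegrable (by fun_prop) _ _
  rw [hasDerivAt_iff_tendsto_slope_zero, ← h0]
  refine ((hQ.tendsto 0).mono_left nhdsWithin_le_nhds).congr' ?_
  filter_upwards [self_mem_nhdsWithin] with h hh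
  have hh : h ≠ 0 := hh
  rw [key, smul_eq_mul, ← mul_assoc, inv_mul_cancel₀ hh, one_mul]

lemma k_ftc {f fx fz g gx gz : ℝ × ℝ → ℝ} (hf : KC1 f fx fz) (hg : KC1 g gx gz) {P : ℝ}
    (hPf : ∀ x z, f (x + P, z) = f (x, z)) (hPg : ∀ x z, g (x + P, z) = g (x, z)) (a b : ℝ) :
    ∫ z in a..b, ∫ x in (0:ℝ)..P, (fx (x, z) * gz (x, z) - fz (x, z) * gx (x, z))
    = (∫ x in (0:ℝ)..P, fx (x, b) * g (x, b)) - ∫ x in (0:ℝ)..P, fx (x, a) * g (x, a) := by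
  have c1 := hf.c; have c2 := hf.cx; have c3 := hg.c; have c4 := hg.cx
  have c5 := hf.cz; have c6 := hg.cz
  exact intervalIntegral.integral_eq_sub_of_hasDerivAt
    (f := fun z => ∫ x in (0:ℝ)..P, fx (x, z) * g (x, z))
    (fun z _ => k_deriv hf hg hPf hPg z)
    ((k_param (f := fun q => fx q * gz q - fz q * gx q) (by fun_prop) 0 P).intervalIntegrable _ _)

/-- double integral monotonicity -/
lemma k_mono {A B : ℝ × ℝ → ℝ} (hA : Continuous A) (hB : Continuous B) {P a b : ℝ} (hP : 0 ≤ P)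
    (hab : a ≤ b) (h : ∀ q, A q ≤ B q) :
    ∫ z in a..b, ∫ x in (0:ℝ)..P, A (x, z) ≤ ∫ z in a..b, ∫ x in (0:ℝ)..P, B (x, z) := by
  refine intervalIntegral.integral_mono_on hab ((k_param hA 0 P).intervalIntegrable _ _)
    ((k_param hB 0 P).intervalIntegrable _ _) fun z _ => ?_
  exact intervalIntegral.integral_mono_on hP (Continuous.intervalIntegrable (by fun_prop) _ _)
    (Continuous.intervalIntegrable (by fun_prop) _ _) fun x _ => h _

lemma k_add {A B : ℝ × ℝ → ℝ} (hA : Continuous A) (hB : Continuous B) (P a b : ℝ) :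
    ∫ z in a..b, ∫ x in (0:ℝ)..P, (A (x, z) + B (x, z))
    = (∫ z in a..b, ∫ x in (0:ℝ)..P, A (x, z)) + ∫ z in a..b, ∫ x in (0:ℝ)..P, B (x, z) := by
  rw [← intervalIntegral.integral_add ((k_param hA 0 P).intervalIntegrable _ _)
    ((k_param hB 0 P).intervalIntegrable _ _)]
  congr 1; ext z
  rw [← intervalIntegral.integral_add (Continuous.intervalIntegrable (by fun_prop) _ _)
    (Continuous.intervalIntegrable (by fun_prop) _ _)]

lemma k_smul (A : ℝ × ℝ → ℝ) (c P a b : ℝ) :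
    ∫ z in a..b, ∫ x in (0:ℝ)..P, (c * A (x, z))
    = c * ∫ z in a..b, ∫ x in (0:ℝ)..P, A (x, z) := by
  simp_rw [intervalIntegral.integral_const_mul]

/-- periodic-periodic case -/
lemma k_per {f fx fz g gx gz : ℝ × ℝ → ℝ} (hf : KC1 f fx fz) (hg : KC1 g gx gz) {P R : ℝ}
    (hP : 0 ≤ P) (hR : 0 ≤ R)
    (hPf : ∀ x z, f (x + P, z) = f (x, z)) (hPg : ∀ x z, g (x + P, z) = g (x, z))
    (hRf : ∀ x z, f (x, z + R) = f (x, z)) (hRg : ∀ x z, g (x, z + R) = g (x, z)) :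
    ∫ z in (0:ℝ)..R, ∫ x in (0:ℝ)..P, (fz (x, z) ^ 2 + gx (x, z) ^ 2)
    ≤ ∫ z in (0:ℝ)..R, ∫ x in (0:ℝ)..P,
      (fx (x, z) ^ 2 + gz (x, z) ^ 2 + (fz (x, z) + gx (x, z)) ^ 2) := by
  have c1 := hf.c; have c2 := hf.cx; have c3 := hg.c; have c4 := hg.cx
  have c5 := hf.cz; have c6 := hg.cz
  have h1 := k_ftc hf hg hPf hPg 0 R
  have e1 : ∀ x, fx (x, R) = fx (x, 0) := fun x =>
    k_fxeq hf (fun t => by have := hRf t 0; rwa [zero_add] at this) x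
  have e2 : ∀ x, g (x, R) = g (x, 0) := fun t => by have := hRg t 0; rwa [zero_add] at this
  simp_rw [e1, e2, sub_self] at h1
  have h2 := k_mono (A := fun q => fz q ^ 2 + gx q ^ 2 + (-2) * (fx q * gz q - fz q * gx q))
    (B := fun q => fx q ^ 2 + gz q ^ 2 + (fz q + gx q) ^ 2) (by fun_prop) (by fun_prop) hP hR
    (fun q => by nlinarith [sq_nonneg (fx q + gz q)])
  rw [k_add (A := fun q => fz q ^ 2 + gx q ^ 2)
    (B := fun q => (-2) * (fx q * gz q - fz q * gx q)) (by fun_prop) (by fun_prop),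
    k_smul (fun q => fx q * gz q - fz q * gx q), h1] at h2
  linarith

/-- Dirichlet-free case -/
lemma k_dir {f fx fz g gx gz : ℝ × ℝ → ℝ} (hf : KC1 f fx fz) (hg : KC1 g gx gz) {P b : ℝ}
    (hP : 0 ≤ P) (hb : 0 < b)
    (hPf : ∀ x z, f (x + P, z) = f (x, z)) (hPg : ∀ x z, g (x + P, z) = g (x, z))
    (hf0 : ∀ x, f (x, -b) = 0) (hg0 : ∀ x, g (x, -b) = 0) :
    ∫ z in (-b)..1, ∫ x in (0:ℝ)..P, (fz (x, z) ^ 2 + gx (x, z) ^ 2)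
    ≤ 92 * ∫ z in (-b)..1, ∫ x in (0:ℝ)..P,
      (fx (x, z) ^ 2 + gz (x, z) ^ 2 + (fz (x, z) + gx (x, z)) ^ 2) := by
  have c1 := hf.c; have c2 := hf.cx; have c3 := hg.c; have c4 := hg.cx
  have c5 := hf.cz; have c6 := hg.cz
  have fx0 : ∀ x, fx (x, -b) = 0 := fun x => by
    have h1 := hf.dx x (-b)
    have : (fun t => f (t, -b)) = fun t => 0 := by ext t; exact hf0 t
    rw [this] at h1
    exact h1.unique (hasDerivAt_const x 0)
  set m := (1 - b) / 2 with hm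
  have hF : KC1 (fun q => 3 * f (q.1, 1 - q.2) - 2 * f (q.1, 1 - 2 * q.2))
      (fun q => 3 * fx (q.1, 1 - q.2) - 2 * fx (q.1, 1 - 2 * q.2))
      (fun q => -3 * fz (q.1, 1 - q.2) + 4 * fz (q.1, 1 - 2 * q.2)) := by
    refine ⟨by fun_prop, by fun_prop, by fun_prop, fun x z => ?_, fun x z => ?_⟩
    · exact ((hf.dx x (1 - z)).const_mul 3).sub ((hf.dx x (1 - 2 * z)).const_mul 2)
    · have d1 : HasDerivAt (fun t : ℝ => 1 - t) (-1) z := by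
        simpa using (hasDerivAt_id z).const_sub 1
      have d2 : HasDerivAt (fun t : ℝ => 1 - 2 * t) (-2) z := by
        simpa using ((hasDerivAt_id z).const_mul 2).const_sub 1
      have := (((hf.dz x _).comp z d1).const_mul 3).sub (((hf.dz x _).comp z d2).const_mul 2)
      refine this.congr_deriv ?_
      ring
  have hG : KC1 (fun q => -3 * g (q.1, 1 - q.2) + 4 * g (q.1, 1 - 2 * q.2))
      (fun q => -3 * gx (q.1, 1 - q.2) + 4 * gx (q.1, 1 - 2 * q.2))
      (fun q => 3 * gz (q.1, 1 - q.2) - 8 * gz (q.1, 1 - 2 * q.2)) := by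
    refine ⟨by fun_prop, by fun_prop, by fun_prop, fun x z => ?_, fun x z => ?_⟩
    · exact ((hg.dx x (1 - z)).const_mul (-3)).add ((hg.dx x (1 - 2 * z)).const_mul 4)
    · have d1 : HasDerivAt (fun t : ℝ => 1 - t) (-1) z := by
        simpa using (hasDerivAt_id z).const_sub 1
      have d2 : HasDerivAt (fun t : ℝ => 1 - 2 * t) (-2) z := by
        simpa using ((hasDerivAt_id z).const_mul 2).const_sub 1
      have := (((hg.dz x _).comp z d1).const_mul (-3)).add (((hg.dz x _).comp z d2).const_mul 4)
      refine this.congr_deriv ?_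
      ring
  have i1 := k_ftc hf hg hPf hPg (-b) 1
  have i2 := k_ftc hf hg hPf hPg (-b) m
  have i3 := k_ftc hF hG (P := P) (fun x z => by simp only [hPf]) (fun x z => by simp only [hPg])
    0 ((1 + b) / 2)
  have r1 : 1 - (1 + b) / 2 = m := by rw [hm]; ring
  have r2 : 1 - 2 * ((1 + b) / 2) = -b := by ring
  simp only [r1, r2, hg0, fx0, mul_zero, sub_zero, add_zero,
    intervalIntegral.integral_zero] at i1 i2 i3
  have e3 : ∀ x, 3 * fx (x, m) * (-3 * g (x, m)) = (-9) * (fx (x, m) * g (x, m)) := fun x => by ring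
  have e4 : ∀ x, (3 * fx (x, 1) - 2 * fx (x, 1)) * (-3 * g (x, 1) + 4 * g (x, 1))
    = fx (x, 1) * g (x, 1) := fun x => by ring
  simp_rw [e3, e4, intervalIntegral.integral_const_mul] at i3
  rw [← i1, ← i2] at i3
  have hm1 : -b ≤ m := by rw [hm]; linarith
  have hm2 : m ≤ 1 := by rw [hm]; linarith
  set E : ℝ × ℝ → ℝ := fun q => fx q ^ 2 + gz q ^ 2 + (fz q + gx q) ^ 2 with hE
  have cE : Continuous E := by fun_prop
  have E0 : ∀ q, 0 ≤ E q := fun q => by simp only [hE]; positivity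
  set J : ℝ × ℝ → ℝ := fun q => fx q * gz q - fz q * gx q with hJ
  have cJ : Continuous J := by fun_prop
  -- first
  have s1 := k_mono (A := fun q => fz q ^ 2 + gx q ^ 2 + (-2) * J q) (B := E) (a := -b) (b := 1)
    (by fun_prop) cE hP (by linarith)
    (fun q => by simp only [hE, hJ]; nlinarith [sq_nonneg (fx q + gz q)])
  rw [k_add (A := fun q => fz q ^ 2 + gx q ^ 2) (B := fun q => -2 * J q) (by fun_prop)
    (by fun_prop), k_smul J] at s1
  have s2 := k_mono (A := fun q => (-18) * J q) (B := fun q => 9 * E q) (a := -b) (b := m)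
    (by fun_prop) (by fun_prop) hP hm1
    (fun q => by
      simp only [hE, hJ]
      nlinarith [sq_nonneg (fx q + gz q), sq_nonneg (fz q), sq_nonneg (gx q)])
  rw [k_smul J, k_smul E] at s2
  have s3 := k_mono (a := 0) (b := (1 + b) / 2) (P := P)
    (A := fun q => (-2) * ((3 * fx (q.1, 1 - q.2) - 2 * fx (q.1, 1 - 2 * q.2)) *
      (3 * gz (q.1, 1 - q.2) - 8 * gz (q.1, 1 - 2 * q.2))
      - (-3 * fz (q.1, 1 - q.2) + 4 * fz (q.1, 1 - 2 * q.2)) *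
      (-3 * gx (q.1, 1 - q.2) + 4 * gx (q.1, 1 - 2 * q.2))))
    (B := fun q => 18 * E (q.1, 1 - q.2) + 128 * E (q.1, 1 - 2 * q.2))
    (by fun_prop) (by fun_prop) hP (by linarith)
    (fun q => by
      simp only [hE]
      generalize fx (q.1, 1 - q.2) = a1
      generalize fx (q.1, 1 - 2 * q.2) = a2
      generalize fz (q.1, 1 - q.2) = a3
      generalize fz (q.1, 1 - 2 * q.2) = a4
      generalize gx (q.1, 1 - q.2) = b1
      generalize gx (q.1, 1 - 2 * q.2) = b2
      generalize gz (q.1, 1 - q.2) = b3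
      generalize gz (q.1, 1 - 2 * q.2) = b4
      have t1 : -2 * ((3 * a1 - 2 * a2) * (3 * b3 - 8 * b4)) ≤
        (3 * a1 - 2 * a2) ^ 2 + (3 * b3 - 8 * b4) ^ 2 := by
        nlinarith [sq_nonneg ((3 * a1 - 2 * a2) + (3 * b3 - 8 * b4))]
      have t2 : 2 * ((-3 * a3 + 4 * a4) * (-3 * b1 + 4 * b2)) ≤
        (-3 * (a3 + b1) + 4 * (a4 + b2)) ^ 2 := by
        nlinarith [sq_nonneg (-3 * a3 + 4 * a4), sq_nonneg (-3 * b1 + 4 * b2)]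
      have t3 : (-3 * (a3 + b1) + 4 * (a4 + b2)) ^ 2 ≤ 18 * (a3 + b1) ^ 2 + 32 * (a4 + b2) ^ 2 := by
        nlinarith [sq_nonneg (3 * (a3 + b1) + 4 * (a4 + b2))]
      have t4 : (3 * a1 - 2 * a2) ^ 2 ≤ 18 * a1 ^ 2 + 8 * a2 ^ 2 := by
        nlinarith [sq_nonneg (3 * a1 + 2 * a2)]
      have t5 : (3 * b3 - 8 * b4) ^ 2 ≤ 18 * b3 ^ 2 + 128 * b4 ^ 2 := by
        nlinarith [sq_nonneg (3 * b3 + 8 * b4)]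
      nlinarith [sq_nonneg a2, sq_nonneg (a4 + b2)])
  rw [k_smul (fun q => ((3 * fx (q.1, 1 - q.2) - 2 * fx (q.1, 1 - 2 * q.2)) *
      (3 * gz (q.1, 1 - q.2) - 8 * gz (q.1, 1 - 2 * q.2))
      - (-3 * fz (q.1, 1 - q.2) + 4 * fz (q.1, 1 - 2 * q.2)) *
      (-3 * gx (q.1, 1 - q.2) + 4 * gx (q.1, 1 - 2 * q.2)))),
    k_add (A := fun q => 18 * E (q.1, 1 - q.2)) (B := fun q => 128 * E (q.1, 1 - 2 * q.2))
      (by fun_prop) (by fun_prop), k_smul (fun q => E (q.1, 1 - q.2)),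
    k_smul (fun q => E (q.1, 1 - 2 * q.2))] at s3
  simp only at s3
  have u1 := intervalIntegral.integral_comp_sub_left (a := 0) (b := (1 + b) / 2)
    (fun z => ∫ x in (0:ℝ)..P, E (x, z)) 1
  have u2 := intervalIntegral.integral_comp_sub_mul (a := 0) (b := (1 + b) / 2)
    (fun z => ∫ x in (0:ℝ)..P, E (x, z)) (two_ne_zero) 1
  simp only [r1, r2, sub_zero, mul_zero, smul_eq_mul] at u1 u2
  rw [u1, u2] at s3
  have ce := k_param cE 0 P
  have split := intervalIntegral.integral_add_adjacent_intervals
    (ce.intervalIntegrable (μ := volume) (-b) m) (ce.intervalIntegrable (μ := volume) m 1)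
  have n1 : 0 ≤ ∫ z in (-b)..m, ∫ x in (0:ℝ)..P, E (x, z) :=
    intervalIntegral.integral_nonneg hm1 fun z _ =>
      intervalIntegral.integral_nonneg hP fun x _ => E0 _
  have n2 : 0 ≤ ∫ z in m..1, ∫ x in (0:ℝ)..P, E (x, z) :=
    intervalIntegral.integral_nonneg hm2 fun z _ =>
      intervalIntegral.integral_nonneg hP fun x _ => E0 _
  rw [i3] at s3
  simp only [hE, hJ] at s1 s2 s3 split n1 n2 ⊢
  linarith

lemma k_poincare {f f' : ℝ → ℝ} (hf : ∀ z, HasDerivAt f (f' z) z) (hf' : Continuous f') {b : ℝ}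
    (hb : 0 < b) (h0 : f (-b) = 0) :
    ∫ z in (-b)..1, f z ^ 2 ≤ ∫ z in (-b)..1, 4 * (1 + b) ^ 2 * f' z ^ 2 := by
  have c : Continuous f := continuous_iff_continuousAt.2 fun z => (hf z).continuousAt
  have h := intervalIntegral.integral_eq_sub_of_hasDerivAt (a := -b) (b := 1)
    (f := fun t => (t - 1) * f t ^ 2) (f' := fun t => 1 * f t ^ 2 + (t - 1) * (2 * f t * f' t))
    (fun t _ => by
      refine (((hasDerivAt_id t).sub_const 1).mul ((hf t).pow 2)).congr_deriv ?_
      simp)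
    (Continuous.intervalIntegrable (by fun_prop) _ _)
  simp only [h0] at h
  have h2 : ∫ z in (-b)..1, f z ^ 2 ≤ ∫ z in (-b)..1, (4 * (1 + b) ^ 2 * f' z ^ 2
      + 2 * (1 * f z ^ 2 + (z - 1) * (2 * f z * f' z))) := by
    refine intervalIntegral.integral_mono_on (by linarith)
      (Continuous.intervalIntegrable (by fun_prop) _ _)
      (Continuous.intervalIntegrable (by fun_prop) _ _) fun z hz => ?_
    have : (z - 1) ^ 2 ≤ (1 + b) ^ 2 := by nlinarith [hz.1, hz.2]
    nlinarith [sq_nonneg (f z + 2 * (z - 1) * f' z),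
      mul_le_mul_of_nonneg_right this (sq_nonneg (f' z))]
  rw [intervalIntegral.integral_add (Continuous.intervalIntegrable (by fun_prop) _ _)
    (Continuous.intervalIntegrable (by fun_prop) _ _), intervalIntegral.integral_const_mul 2, h] at h2
  linarith


/-- coordinates -/
noncomputable def kp (q : ℝ × ℝ × ℝ) : EuclideanSpace ℝ (Fin 3) := !₂[q.1, q.2.1, q.2.2]

lemma kp_cont : Continuous kp := by
  unfold kp
  refine (PiLp.continuous_toLp 2 _).comp (continuous_pi fun i => ?_)
  fin_cases i <;> simp <;> fun_prop

noncomputable def kpe : ℝ × ℝ × ℝ ≃ᵐ EuclideanSpace ℝ (Fin 3) :=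
  ((MeasurableEquiv.prodCongr (MeasurableEquiv.refl ℝ) MeasurableEquiv.finTwoArrow.symm).trans
    (MeasurableEquiv.piFinSuccAbove (fun _ : Fin 3 => ℝ) 0).symm).trans
    (MeasurableEquiv.toLp 2 (Fin 3 → ℝ))

lemma kpe_eq : ⇑kpe = kp := by
  ext q i
  fin_cases i <;> rfl

lemma kpe_mp : MeasurePreserving kpe volume volume := by
  refine MeasurePreserving.trans (μb := volume) (MeasurePreserving.trans (μb := volume) ?_ ?_) ?_
  · exact (MeasurePreserving.id volume).prod (volume_preserving_finTwoArrow ℝ).symm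
  · exact (volume_preserving_piFinSuccAbove (fun _ : Fin 3 => ℝ) 0).symm
  · exact PiLp.volume_preserving_toLp (Fin 3)

lemma k_Ioo (f : ℝ → ℝ) {a b : ℝ} (h : a ≤ b) : ∫ x in Ioo a b, f x = ∫ x in a..b, f x := by
  rw [intervalIntegral.integral_of_le h, integral_Ioc_eq_integral_Ioo]

def kbox (P R b : ℝ) : Set (EuclideanSpace ℝ (Fin 3)) :=
  {x | x 0 ∈ Ioo 0 P ∧ x 1 ∈ Ioo 0 R ∧ x 2 ∈ Ioo (-b) 1}

lemma kbox_pre (P R b : ℝ) : kpe ⁻¹' kbox P R b = Ioo 0 P ×ˢ Ioo 0 R ×ˢ Ioo (-b) 1 := by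
  rw [kpe_eq]
  ext q
  simp [kbox, kp]

lemma kbox_int {h : EuclideanSpace ℝ (Fin 3) → ℝ} (hh : Continuous h) (P R b : ℝ) :
    IntegrableOn h (kbox P R b) := by
  rw [← kpe_mp.integrableOn_comp_preimage kpe.measurableEmbedding, kbox_pre, kpe_eq]
  have : IntegrableOn (h ∘ kp) (Icc 0 P ×ˢ Icc 0 R ×ˢ Icc (-b) 1) :=
    (hh.comp kp_cont).continuousOn.integrableOn_compact
      (isCompact_Icc.prod (isCompact_Icc.prod isCompact_Icc))
  exact this.mono_set (prod_mono Ioo_subset_Icc_self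
    (prod_mono Ioo_subset_Icc_self Ioo_subset_Icc_self))

lemma kbox_fubini {h : EuclideanSpace ℝ (Fin 3) → ℝ} (hh : Continuous h) {P R b : ℝ}
    (hP : 0 ≤ P) (hR : 0 ≤ R) (hb : 0 < b) :
    ∫ x in kbox P R b, h x = ∫ x in (0:ℝ)..P, ∫ y in (0:ℝ)..R, ∫ z in (-b)..1, h (kp (x, y, z)) := by
  have hi := kbox_int hh P R b
  rw [← kpe_mp.integrableOn_comp_preimage kpe.measurableEmbedding, kbox_pre, kpe_eq] at hi
  rw [← kpe_mp.setIntegral_preimage_emb kpe.measurableEmbedding, kbox_pre, kpe_eq,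
    Measure.volume_eq_prod, setIntegral_prod (fun q => h (kp q)) hi, ← k_Ioo _ hP]
  refine setIntegral_congr_fun measurableSet_Ioo fun x _ => ?_
  have h2 : IntegrableOn (fun q : ℝ × ℝ => h (kp (x, q))) (Icc 0 R ×ˢ Icc (-b) 1) :=
    ((hh.comp kp_cont).comp (by fun_prop : Continuous fun q : ℝ × ℝ => (x, q))).continuousOn.integrableOn_compact
      (isCompact_Icc.prod isCompact_Icc)
  have h3 := h2.mono_set (prod_mono (Ioo_subset_Icc_self (a := (0:ℝ)) (b := R)) (Ioo_subset_Icc_self (a := -b) (b := 1)))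
  rw [Measure.volume_eq_prod, setIntegral_prod _ h3, ← k_Ioo _ hR]
  refine setIntegral_congr_fun measurableSet_Ioo fun y _ => ?_
  rw [k_Ioo _ (by linarith)]

lemma k_swap {h : ℝ × ℝ → ℝ} (hh : Continuous h) {a b c d : ℝ} (hab : a ≤ b) (hcd : c ≤ d) :
    ∫ x in a..b, ∫ y in c..d, h (x, y) = ∫ y in c..d, ∫ x in a..b, h (x, y) := by
  have hi : IntegrableOn h (Ioo a b ×ˢ Ioo c d) :=
    (hh.continuousOn.integrableOn_compact (isCompact_Icc.prod isCompact_Icc)).mono_set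
      (prod_mono (Ioo_subset_Icc_self (a := a) (b := b)) (Ioo_subset_Icc_self (a := c) (b := d)))
  simp_rw [← k_Ioo _ hab, ← k_Ioo _ hcd]
  refine integral_integral_swap (f := fun x y => h (x, y)) ?_
  rw [Measure.prod_restrict]
  exact hi

lemma k_par {X : Type*} [TopologicalSpace X] {f : X × ℝ → ℝ} (hf : Continuous f) (a b : ℝ) :
    Continuous fun z => ∫ x in a..b, f (z, x) :=
  intervalIntegral.continuous_parametric_intervalIntegral_of_continuous'
    (f := fun z x => f (z, x)) (by unfold Function.uncurry; fun_prop) a b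

lemma k_imono {A B : ℝ → ℝ} (hA : Continuous A) (hB : Continuous B) {a b : ℝ} (hab : a ≤ b)
    (h : ∀ x, A x ≤ B x) : ∫ x in a..b, A x ≤ ∫ x in a..b, B x :=
  intervalIntegral.integral_mono_on hab (hA.intervalIntegrable _ _) (hB.intervalIntegrable _ _)
    fun x _ => h x

section slices

variable {A B : EuclideanSpace ℝ (Fin 3) → ℝ} {P R b : ℝ}

lemma k_slice3 (hA : Continuous A) (hB : Continuous B) (hP : 0 ≤ P) (hR : 0 ≤ R) (hb : 0 < b)
    (h : ∀ x y, ∫ z in (-b)..1, A (kp (x, y, z)) ≤ ∫ z in (-b)..1, B (kp (x, y, z))) :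
    ∫ x in kbox P R b, A x ≤ ∫ x in kbox P R b, B x := by
  have hk := kp_cont
  rw [kbox_fubini hA hP hR hb, kbox_fubini hB hP hR hb]
  have c1 : ∀ A : EuclideanSpace ℝ (Fin 3) → ℝ, Continuous A →
      Continuous fun q : ℝ × ℝ => ∫ z in (-b)..1, A (kp (q.1, q.2, z)) := fun A hA =>
    k_par (f := fun q : (ℝ × ℝ) × ℝ => A (kp (q.1.1, q.1.2, q.2))) (by fun_prop) _ _
  have c2 := fun A hA => k_par (c1 A hA) 0 R
  refine k_imono (c2 A hA) (c2 B hB) hP fun x => ?_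
  refine k_imono ((c1 A hA).comp (by fun_prop : Continuous fun y : ℝ => (x, y)))
    ((c1 B hB).comp (by fun_prop : Continuous fun y : ℝ => (x, y))) hR fun y => h x y

lemma k_slice23 (hA : Continuous A) (hB : Continuous B) (hP : 0 ≤ P) (hR : 0 ≤ R) (hb : 0 < b)
    (h : ∀ x, ∫ z in (-b)..1, ∫ y in (0:ℝ)..R, A (kp (x, y, z))
      ≤ ∫ z in (-b)..1, ∫ y in (0:ℝ)..R, B (kp (x, y, z))) :
    ∫ x in kbox P R b, A x ≤ ∫ x in kbox P R b, B x := by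
  have hk := kp_cont
  rw [kbox_fubini hA hP hR hb, kbox_fubini hB hP hR hb]
  have c1 : ∀ A : EuclideanSpace ℝ (Fin 3) → ℝ, Continuous A →
      Continuous fun q : ℝ × ℝ => ∫ z in (-b)..1, A (kp (q.1, q.2, z)) := fun A hA =>
    k_par (f := fun q : (ℝ × ℝ) × ℝ => A (kp (q.1.1, q.1.2, q.2))) (by fun_prop) _ _
  have c2 := fun A hA => k_par (c1 A hA) 0 R
  refine k_imono (c2 A hA) (c2 B hB) hP fun x => ?_
  have s : ∀ A : EuclideanSpace ℝ (Fin 3) → ℝ, Continuous A →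
      ∫ y in (0:ℝ)..R, ∫ z in (-b)..1, A (kp (x, y, z))
      = ∫ z in (-b)..1, ∫ y in (0:ℝ)..R, A (kp (x, y, z)) := fun A hA =>
    k_swap (h := fun q => A (kp (x, q.1, q.2))) (by fun_prop) hR (by linarith)
  have := h x
  rwa [← s A hA, ← s B hB] at this

lemma k_slice13 (hA : Continuous A) (hB : Continuous B) (hP : 0 ≤ P) (hR : 0 ≤ R) (hb : 0 < b)
    (h : ∀ y, ∫ z in (-b)..1, ∫ x in (0:ℝ)..P, A (kp (x, y, z))
      ≤ ∫ z in (-b)..1, ∫ x in (0:ℝ)..P, B (kp (x, y, z))) :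
    ∫ x in kbox P R b, A x ≤ ∫ x in kbox P R b, B x := by
  have hk := kp_cont
  rw [kbox_fubini hA hP hR hb, kbox_fubini hB hP hR hb]
  have c1 : ∀ A : EuclideanSpace ℝ (Fin 3) → ℝ, Continuous A →
      Continuous fun q : ℝ × ℝ => ∫ z in (-b)..1, A (kp (q.1, q.2, z)) := fun A hA =>
    k_par (f := fun q : (ℝ × ℝ) × ℝ => A (kp (q.1.1, q.1.2, q.2))) (by fun_prop) _ _
  rw [k_swap (c1 A hA) hP hR, k_swap (c1 B hB) hP hR]
  have c2 := fun A hA => k_par ((c1 A hA).comp continuous_swap) 0 P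
  refine k_imono (c2 A hA) (c2 B hB) hR fun y => ?_
  have s : ∀ A : EuclideanSpace ℝ (Fin 3) → ℝ, Continuous A →
      ∫ x in (0:ℝ)..P, ∫ z in (-b)..1, A (kp (x, y, z))
      = ∫ z in (-b)..1, ∫ x in (0:ℝ)..P, A (kp (x, y, z)) := fun A hA =>
    k_swap (h := fun q => A (kp (q.1, y, q.2))) (by fun_prop) hP (by linarith)
  have := h y
  rwa [← s A hA, ← s B hB] at this

lemma k_slice12 (hA : Continuous A) (hB : Continuous B) (hP : 0 ≤ P) (hR : 0 ≤ R) (hb : 0 < b)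
    (h : ∀ z, ∫ y in (0:ℝ)..R, ∫ x in (0:ℝ)..P, A (kp (x, y, z))
      ≤ ∫ y in (0:ℝ)..R, ∫ x in (0:ℝ)..P, B (kp (x, y, z))) :
    ∫ x in kbox P R b, A x ≤ ∫ x in kbox P R b, B x := by
  have hk := kp_cont
  have hb1 : -b ≤ 1 := by linarith
  have c1 : ∀ A : EuclideanSpace ℝ (Fin 3) → ℝ, Continuous A →
      Continuous fun q : ℝ × ℝ => ∫ y in (0:ℝ)..R, A (kp (q.1, y, q.2)) := fun A hA =>
    k_par (f := fun q : (ℝ × ℝ) × ℝ => A (kp (q.1.1, q.2, q.1.2))) (by fun_prop) _ _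
  have c2 := fun A hA => k_par ((c1 A hA).comp continuous_swap) 0 P
  have s : ∀ A : EuclideanSpace ℝ (Fin 3) → ℝ, Continuous A →
      ∫ x in (0:ℝ)..P, ∫ y in (0:ℝ)..R, ∫ z in (-b)..1, A (kp (x, y, z))
      = ∫ z in (-b)..1, ∫ x in (0:ℝ)..P, ∫ y in (0:ℝ)..R, A (kp (x, y, z)) := by
    intro A hA
    rw [← k_swap (c1 A hA) hP hb1]
    congr 1; ext x
    exact k_swap (h := fun q => A (kp (x, q.1, q.2))) (by fun_prop) hR hb1
  rw [kbox_fubini hA hP hR hb, kbox_fubini hB hP hR hb, s A hA, s B hB]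
  refine k_imono (c2 A hA) (c2 B hB) hb1 fun z => ?_
  have s : ∀ A : EuclideanSpace ℝ (Fin 3) → ℝ, Continuous A →
      ∫ x in (0:ℝ)..P, ∫ y in (0:ℝ)..R, A (kp (x, y, z))
      = ∫ y in (0:ℝ)..R, ∫ x in (0:ℝ)..P, A (kp (x, y, z)) := fun A hA =>
    k_swap (h := fun q => A (kp (q.1, q.2, z))) (by fun_prop) hP hR
  have := h z
  rwa [← s A hA, ← s B hB] at this

end slices

lemma kp_d0 (x y z : ℝ) : HasDerivAt (fun t => kp (t, y, z)) (EuclideanSpace.single 0 1) x := by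
  have : (fun t => kp (t, y, z)) = fun t =>
      t • (EuclideanSpace.single 0 1 : EuclideanSpace ℝ (Fin 3)) + kp (0, y, z) := by
    ext t i; fin_cases i <;> simp [kp]
  rw [this]
  simpa using ((hasDerivAt_id x).smul_const
    (EuclideanSpace.single 0 1 : EuclideanSpace ℝ (Fin 3))).add_const (kp (0, y, z))

lemma kp_d1 (x y z : ℝ) : HasDerivAt (fun t => kp (x, t, z)) (EuclideanSpace.single 1 1) y := by
  have : (fun t => kp (x, t, z)) = fun t =>
      t • (EuclideanSpace.single 1 1 : EuclideanSpace ℝ (Fin 3)) + kp (x, 0, z) := by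
    ext t i; fin_cases i <;> simp [kp]
  rw [this]
  simpa using ((hasDerivAt_id y).smul_const
    (EuclideanSpace.single 1 1 : EuclideanSpace ℝ (Fin 3))).add_const (kp (x, 0, z))

lemma kp_d2 (x y z : ℝ) : HasDerivAt (fun t => kp (x, y, t)) (EuclideanSpace.single 2 1) z := by
  have : (fun t => kp (x, y, t)) = fun t =>
      t • (EuclideanSpace.single 2 1 : EuclideanSpace ℝ (Fin 3)) + kp (x, y, 0) := by
    ext t i; fin_cases i <;> simp [kp]
  rw [this]
  simpa using ((hasDerivAt_id z).smul_const
    (EuclideanSpace.single 2 1 : EuclideanSpace ℝ (Fin 3))).add_const (kp (x, y, 0))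

lemma kp_s0 (x y z P : ℝ) : kp (x + P, y, z) = kp (x, y, z) + EuclideanSpace.single 0 P := by
  ext i; fin_cases i <;> simp [kp]

lemma kp_s1 (x y z P : ℝ) : kp (x, y + P, z) = kp (x, y, z) + EuclideanSpace.single 1 P := by
  ext i; fin_cases i <;> simp [kp]

lemma kd_chain {u : EuclideanSpace ℝ (Fin 3) → EuclideanSpace ℝ (Fin 3)} (hu : ContDiff ℝ 1 u)
    {c : ℝ → EuclideanSpace ℝ (Fin 3)} {v : EuclideanSpace ℝ (Fin 3)} {t : ℝ}
    (hc : HasDerivAt c v t) (i : Fin 3) :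
    HasDerivAt (fun s => u (c s) i) (fderiv ℝ u (c t) v i) t := by
  have h1 := ((hu.differentiable (by norm_num)) (c t)).hasFDerivAt.comp_hasDerivAt t hc
  exact (EuclideanSpace.proj (𝕜 := ℝ) i).hasFDerivAt.comp_hasDerivAt t h1

lemma korn_box {P R b : ℝ} (hP : 0 ≤ P) (hR : 0 ≤ R) (hb : 0 < b)
    (u : EuclideanSpace ℝ (Fin 3) → EuclideanSpace ℝ (Fin 3)) (hu : ContDiff ℝ 1 u)
    (hu0 : ∀ x, u (x + EuclideanSpace.single 0 P) = u x)
    (hu1 : ∀ x, u (x + EuclideanSpace.single 1 R) = u x)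
    (hub : ∀ x : EuclideanSpace ℝ (Fin 3), x 2 = -b → u x = 0) :
    ∫ x in kbox P R b, ((∑ i : Fin 3, u x i ^ 2)
            + ∑ i : Fin 3, ∑ j : Fin 3,
                (fderiv ℝ u x (EuclideanSpace.single j 1) i) ^ 2)
    ≤ (186 * (1 + 4 * (1 + b) ^ 2)) * ∫ x in kbox P R b, ∑ i : Fin 3, ∑ j : Fin 3,
              (fderiv ℝ u x (EuclideanSpace.single j 1) i
                + fderiv ℝ u x (EuclideanSpace.single i 1) j) ^ 2 := by
  have hk := kp_cont
  have cu : ∀ i, Continuous fun x => u x i := fun i =>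
    (EuclideanSpace.proj (𝕜 := ℝ) i).continuous.comp hu.continuous
  have cd : ∀ j i, Continuous fun x => fderiv ℝ u x (EuclideanSpace.single j 1) i := fun j i =>
    (EuclideanSpace.proj (𝕜 := ℝ) i).continuous.comp
      ((hu.continuous_fderiv (by norm_num)).clm_apply continuous_const)
  obtain ⟨D, hD⟩ : ∃ D : Fin 3 → Fin 3 → EuclideanSpace ℝ (Fin 3) → ℝ,
    D = fun j i x => fderiv ℝ u x (EuclideanSpace.single j 1) i := ⟨_, rfl⟩
  have hD' : ∀ j i x, fderiv ℝ u x (EuclideanSpace.single j 1) i = D j i x := by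
    intro j i x; rw [hD]
  simp only [hD'] at cd ⊢
  have cd' : ∀ j i, Continuous (D j i) := cd
  have d0 : ∀ i x y z, HasDerivAt (fun t => u (kp (t, y, z)) i) (D 0 i (kp (x, y, z))) x :=
    fun i x y z => by rw [← hD']; exact kd_chain hu (kp_d0 x y z) i
  have d1 : ∀ i x y z, HasDerivAt (fun t => u (kp (x, t, z)) i) (D 1 i (kp (x, y, z))) y :=
    fun i x y z => by rw [← hD']; exact kd_chain hu (kp_d1 x y z) i
  have d2 : ∀ i x y z, HasDerivAt (fun t => u (kp (x, y, t)) i) (D 2 i (kp (x, y, z))) z :=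
    fun i x y z => by rw [← hD']; exact kd_chain hu (kp_d2 x y z) i
  have p0 : ∀ i x y z, u (kp (x + P, y, z)) i = u (kp (x, y, z)) i := fun i x y z => by
    rw [kp_s0, hu0]
  have p1 : ∀ i x y z, u (kp (x, y + R, z)) i = u (kp (x, y, z)) i := fun i x y z => by
    rw [kp_s1, hu1]
  have z0 : ∀ i x y, u (kp (x, y, -b)) i = 0 := fun i x y => by
    rw [hub _ (by simp [kp])]; rfl
  have K02 : ∀ i y, KC1 (fun q => u (kp (q.1, y, q.2)) i) (fun q => D 0 i (kp (q.1, y, q.2)))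
      (fun q => D 2 i (kp (q.1, y, q.2))) := fun i y =>
    ⟨(cu i).comp (by fun_prop), by fun_prop, by fun_prop, fun x z => d0 i x y z,
      fun x z => d2 i x y z⟩
  have K12 : ∀ i x, KC1 (fun q => u (kp (x, q.1, q.2)) i) (fun q => D 1 i (kp (x, q.1, q.2)))
      (fun q => D 2 i (kp (x, q.1, q.2))) := fun i x =>
    ⟨(cu i).comp (by fun_prop), by fun_prop, by fun_prop, fun y z => d1 i x y z,
      fun y z => d2 i x y z⟩
  have K01 : ∀ i z, KC1 (fun q => u (kp (q.1, q.2, z)) i) (fun q => D 0 i (kp (q.1, q.2, z)))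
      (fun q => D 1 i (kp (q.1, q.2, z))) := fun i z =>
    ⟨(cu i).comp (by fun_prop), by fun_prop, by fun_prop, fun x y => d0 i x y z,
      fun x y => d1 i x y z⟩
  have I02 := k_slice13 (P := P) (R := R) (b := b) (A := fun x => D 2 0 x ^ 2 + D 0 2 x ^ 2)
    (B := fun x => 92 * (D 0 0 x ^ 2 + D 2 2 x ^ 2 + (D 2 0 x + D 0 2 x) ^ 2))
    (by fun_prop) (by fun_prop) hP hR hb (fun y => by
      simp_rw [intervalIntegral.integral_const_mul]
      exact k_dir (K02 0 y) (K02 2 y) hP hb (fun x z => p0 0 x y z) (fun x z => p0 2 x y z)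
        (fun x => z0 0 x y) (fun x => z0 2 x y))
  have I12 := k_slice23 (P := P) (R := R) (b := b) (A := fun x => D 2 1 x ^ 2 + D 1 2 x ^ 2)
    (B := fun x => 92 * (D 1 1 x ^ 2 + D 2 2 x ^ 2 + (D 2 1 x + D 1 2 x) ^ 2))
    (by fun_prop) (by fun_prop) hP hR hb (fun x => by
      simp_rw [intervalIntegral.integral_const_mul]
      exact k_dir (K12 1 x) (K12 2 x) hR hb (fun y z => p1 1 x y z) (fun y z => p1 2 x y z)
        (fun y => z0 1 x y) (fun y => z0 2 x y))
  have I01 := k_slice12 (P := P) (R := R) (b := b) (A := fun x => D 1 0 x ^ 2 + D 0 1 x ^ 2)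
    (B := fun x => D 0 0 x ^ 2 + D 1 1 x ^ 2 + (D 1 0 x + D 0 1 x) ^ 2)
    (by fun_prop) (by fun_prop) hP hR hb (fun z => by
      exact k_per (K01 0 z) (K01 1 z) hP hR (fun x y => p0 0 x y z) (fun x y => p0 1 x y z)
        (fun x y => p1 0 x y z) (fun x y => p1 1 x y z))
  have IP : ∀ i, ∫ x in kbox P R b, u x i ^ 2
      ≤ ∫ x in kbox P R b, 4 * (1 + b) ^ 2 * D 2 i x ^ 2 := fun i =>
    k_slice3 (A := fun x => u x i ^ 2) (B := fun x => 4 * (1 + b) ^ 2 * D 2 i x ^ 2)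
      ((cu i).pow 2) (by fun_prop) hP hR hb (fun x y =>
        k_poincare (f := fun z => u (kp (x, y, z)) i) (f' := fun z => D 2 i (kp (x, y, z)))
          (fun z => d2 i x y z) (by fun_prop) hb (z0 i x y))
  have int : ∀ h : EuclideanSpace ℝ (Fin 3) → ℝ, Continuous h →
      Integrable h (volume.restrict (kbox P R b)) := fun h hh => kbox_int hh P R b
  have cu2 : ∀ i, Continuous fun x => u x i ^ 2 := fun i => (cu i).pow 2
  set W : ℝ := ∫ x in kbox P R b, ∑ i : Fin 3, ∑ j : Fin 3, (D j i x + D i j x) ^ 2 with hW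
  have mono : ∀ h k : EuclideanSpace ℝ (Fin 3) → ℝ, Continuous h → Continuous k →
      (∀ x, h x ≤ k x) → ∫ x in kbox P R b, h x ≤ ∫ x in kbox P R b, k x := fun h k hh hk H =>
    integral_mono (int h hh) (int k hk) H
  have cW : Continuous fun x => ∑ i : Fin 3, ∑ j : Fin 3, (D j i x + D i j x) ^ 2 := by fun_prop
  have W02 : ∫ x in kbox P R b, 92 * (D 0 0 x ^ 2 + D 2 2 x ^ 2 + (D 2 0 x + D 0 2 x) ^ 2)
      ≤ 92 * W := by
    rw [integral_const_mul]
    refine mul_le_mul_of_nonneg_left (mono _ _ (by fun_prop) cW fun x => ?_) (by norm_num)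
    simp only [Fin.sum_univ_three]
    nlinarith [sq_nonneg (D 0 0 x), sq_nonneg (D 1 1 x), sq_nonneg (D 2 2 x),
      sq_nonneg (D 0 1 x + D 1 0 x), sq_nonneg (D 0 2 x + D 2 0 x), sq_nonneg (D 1 2 x + D 2 1 x)]
  have W12 : ∫ x in kbox P R b, 92 * (D 1 1 x ^ 2 + D 2 2 x ^ 2 + (D 2 1 x + D 1 2 x) ^ 2)
      ≤ 92 * W := by
    rw [integral_const_mul]
    refine mul_le_mul_of_nonneg_left (mono _ _ (by fun_prop) cW fun x => ?_) (by norm_num)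
    simp only [Fin.sum_univ_three]
    nlinarith [sq_nonneg (D 0 0 x), sq_nonneg (D 1 1 x), sq_nonneg (D 2 2 x),
      sq_nonneg (D 0 1 x + D 1 0 x), sq_nonneg (D 0 2 x + D 2 0 x), sq_nonneg (D 1 2 x + D 2 1 x)]
  have W01 : ∫ x in kbox P R b, (D 0 0 x ^ 2 + D 1 1 x ^ 2 + (D 1 0 x + D 0 1 x) ^ 2) ≤ W := by
    refine mono _ _ (by fun_prop) cW fun x => ?_
    simp only [Fin.sum_univ_three]
    nlinarith [sq_nonneg (D 0 0 x), sq_nonneg (D 1 1 x), sq_nonneg (D 2 2 x),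
      sq_nonneg (D 0 1 x + D 1 0 x), sq_nonneg (D 0 2 x + D 2 0 x), sq_nonneg (D 1 2 x + D 2 1 x)]
  have W3 : ∫ x in kbox P R b, (D 0 0 x ^ 2 + D 1 1 x ^ 2 + D 2 2 x ^ 2) ≤ W := by
    refine mono _ _ (by fun_prop) cW fun x => ?_
    simp only [Fin.sum_univ_three]
    nlinarith [sq_nonneg (D 0 0 x), sq_nonneg (D 1 1 x), sq_nonneg (D 2 2 x),
      sq_nonneg (D 0 1 x + D 1 0 x), sq_nonneg (D 0 2 x + D 2 0 x), sq_nonneg (D 1 2 x + D 2 1 x)]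
  have cG : Continuous fun x => ∑ i : Fin 3, ∑ j : Fin 3, D j i x ^ 2 := by fun_prop
  have G1 : ∫ x in kbox P R b, ∑ i : Fin 3, ∑ j : Fin 3, D j i x ^ 2 ≤ 186 * W := by
    have : (fun x => ∑ i : Fin 3, ∑ j : Fin 3, D j i x ^ 2) = fun x =>
      (((D 0 0 x ^ 2 + D 1 1 x ^ 2 + D 2 2 x ^ 2) + (D 2 0 x ^ 2 + D 0 2 x ^ 2))
        + (D 2 1 x ^ 2 + D 1 2 x ^ 2)) + (D 1 0 x ^ 2 + D 0 1 x ^ 2) := by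
      ext x; simp only [Fin.sum_univ_three]; ring
    rw [this, integral_add (int _ (by fun_prop)) (int _ (by fun_prop)),
      integral_add (int _ (by fun_prop)) (int _ (by fun_prop)),
      integral_add (int _ (by fun_prop)) (int _ (by fun_prop))]
    linarith
  have G2 : ∫ x in kbox P R b, ∑ i : Fin 3, u x i ^ 2
      ≤ 4 * (1 + b) ^ 2 * ∫ x in kbox P R b, ∑ i : Fin 3, ∑ j : Fin 3, D j i x ^ 2 := by
    rw [integral_finsetSum _ (fun i _ => int _ (cu2 i))]
    refine (Finset.sum_le_sum fun i _ => IP i).trans ?_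
    rw [← integral_finsetSum _ (fun i _ => int _ (by fun_prop)), ← integral_const_mul]
    refine mono _ _ (by fun_prop) (by fun_prop) fun x => ?_
    simp only
    rw [← Finset.mul_sum]
    refine mul_le_mul_of_nonneg_left (Finset.sum_le_sum fun i _ => ?_) (by positivity)
    exact Finset.single_le_sum (f := fun j => D j i x ^ 2) (fun j _ => sq_nonneg _)
      (Finset.mem_univ 2)
  rw [integral_add (int _ (continuous_finsetSum _ fun i _ => cu2 i)) (int _ cG)]
  have hB : 0 ≤ 4 * (1 + b) ^ 2 := by positivity
  have := mul_le_mul_of_nonneg_left G1 hB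
  linarith

/-- Korn's inequality on the horizontally periodic slab with bottom Dirichlet condition
(Lemma B.6): for `Ω = (0,2πL₁)×(0,2πL₂)×(-b,1)` there is `C > 0` depending only on
`L₁, L₂, b` such that every horizontally periodic `C¹` vector field `u` vanishing on the
bottom `{x₃ = -b}` satisfies `∫_Ω (|u|² + |∇u|²) ≤ C ∫_Ω |𝔻u|²`, where
`𝔻u = ∇u + (∇u)ᵀ`. -/
theorem korn_inequality_periodic_slab
    (L1 L2 b : ℝ) (hL1 : 0 < L1) (hL2 : 0 < L2) (hb : 0 < b) :
    ∃ C : ℝ, 0 < C ∧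
      ∀ u : EuclideanSpace ℝ (Fin 3) → EuclideanSpace ℝ (Fin 3),
        ContDiff ℝ 1 u →
        (∀ x, u (x + EuclideanSpace.single 0 (2 * Real.pi * L1)) = u x) →
        (∀ x, u (x + EuclideanSpace.single 1 (2 * Real.pi * L2)) = u x) →
        (∀ x : EuclideanSpace ℝ (Fin 3), x 2 = -b → u x = 0) →
        (∫ x in {x : EuclideanSpace ℝ (Fin 3) |
            x 0 ∈ Set.Ioo 0 (2 * Real.pi * L1) ∧ x 1 ∈ Set.Ioo 0 (2 * Real.pi * L2) ∧
            x 2 ∈ Set.Ioo (-b) 1},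
          ((∑ i : Fin 3, u x i ^ 2)
            + ∑ i : Fin 3, ∑ j : Fin 3,
                (fderiv ℝ u x (EuclideanSpace.single j 1) i) ^ 2))
        ≤ C * ∫ x in {x : EuclideanSpace ℝ (Fin 3) |
            x 0 ∈ Set.Ioo 0 (2 * Real.pi * L1) ∧ x 1 ∈ Set.Ioo 0 (2 * Real.pi * L2) ∧
            x 2 ∈ Set.Ioo (-b) 1},
            ∑ i : Fin 3, ∑ j : Fin 3,
              (fderiv ℝ u x (EuclideanSpace.single j 1) i
                + fderiv ℝ u x (EuclideanSpace.single i 1) j) ^ 2 := by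
  refine ⟨186 * (1 + 4 * (1 + b) ^ 2), by positivity, fun u hu h0 h1 hbot => ?_⟩
  exact korn_box (by positivity) (by positivity) hb u hu h0 h1 hbot
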